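/- The monic continuous q-Hermite polynomial Pₙ(x) = 2^{−n}Hₙ(x|q) admits the expansion 2^{−n}Hₙ(x|q) = Σ_{k=0}^{⌊n/2⌋} ((q^{−n};q)_{2k}/(q²;q²)ₖ)·(−q^{n+1}/4)ᵏ · K_{n−2k}(x), where on x = cos θ (with e^{iθ} = q^{s}, x(s) = (q^{−s}+q^{s})/2) the basis is Kⱼ(x(s)) = (q^{−s}/2)ʲ(1 + q^{2s})(−q^{−j+2}q^{2s}; q²)_{j−1} for j ≥ 1 and K₀ = 1. -/

import Mathlib

/-- q-Pochhammer symbol `(a;t)ₖ`. -/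
noncomputable def qpoch (a t : ℂ) (k : ℕ) : ℂ := ∏ j ∈ Finset.range k, (1 - a * t ^ j)

theorem qpoch_zero (a t : ℂ) : qpoch a t 0 = 1 := by simp [qpoch]

theorem qpoch_succ (a t : ℂ) (k : ℕ) :
    qpoch a t (k + 1) = qpoch a t k * (1 - a * t ^ k) := by
  simp [qpoch, Finset.prod_range_succ]

theorem qpoch_succ_left (a t : ℂ) (k : ℕ) :
    qpoch a t (k + 1) = (1 - a) * qpoch (a * t) t k := by
  simp only [qpoch, Finset.prod_range_succ', pow_zero, mul_one]
  rw [mul_comm]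
  congr 1
  refine Finset.prod_congr rfl fun i _ => ?_
  ring

theorem qpoch_self_ne_zero {t : ℂ} (ht : ∀ k : ℕ, 1 - t ^ (k + 1) ≠ 0) (k : ℕ) :
    qpoch t t k ≠ 0 :=
  Finset.prod_ne_zero_iff.2 fun j _ => by rw [← pow_succ']; exact ht j

theorem qpoch_inv_pow_eq_zero {q : ℂ} (hq : q ≠ 0) {n m : ℕ} (h : n < m) :
    qpoch (q ^ (-(n : ℤ))) q m = 0 :=
  Finset.prod_eq_zero (Finset.mem_range.2 h) (by simp [hq])

/-- The three-term recurrence for the convolution of two `q`-exponential series. -/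
theorem sum_antidiagonal_recurrence {q a b : ℂ} {u v : ℕ → ℂ}
    (hu : ∀ i, (1 - q ^ (i + 1)) * u (i + 1) = a * u i)
    (hv : ∀ i, (1 - q ^ (i + 1)) * v (i + 1) = b * v i) (n : ℕ) :
    (1 - q ^ (n + 2)) * ∑ p ∈ Finset.HasAntidiagonal.antidiagonal (n + 2), u p.1 * v p.2 =
      (a + b) * ∑ p ∈ Finset.HasAntidiagonal.antidiagonal (n + 1), u p.1 * v p.2 -
        a * b * ∑ p ∈ Finset.HasAntidiagonal.antidiagonal n, u p.1 * v p.2 := by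
  have h₁ : ∑ p ∈ Finset.HasAntidiagonal.antidiagonal (n + 2), ((1 - q ^ p.1) * u p.1) * v p.2 =
      a * ∑ p ∈ Finset.HasAntidiagonal.antidiagonal (n + 1), u p.1 * v p.2 := by
    rw [Finset.Nat.sum_antidiagonal_succ]
    simp [hu, Finset.mul_sum, mul_assoc]
  have h₂ : ∑ p ∈ Finset.HasAntidiagonal.antidiagonal (n + 2), u p.1 * ((1 - q ^ p.2) * v p.2) =
      b * ∑ p ∈ Finset.HasAntidiagonal.antidiagonal (n + 1), u p.1 * v p.2 := by
    rw [Finset.Nat.sum_antidiagonal_succ']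
    simp [hv, Finset.mul_sum, mul_left_comm]
  have h₃ : ∑ p ∈ Finset.HasAntidiagonal.antidiagonal (n + 2),
      ((1 - q ^ p.1) * u p.1) * ((1 - q ^ p.2) * v p.2) =
      a * b * ∑ p ∈ Finset.HasAntidiagonal.antidiagonal n, u p.1 * v p.2 := by
    rw [Finset.Nat.sum_antidiagonal_succ, Finset.Nat.sum_antidiagonal_succ']
    simp only [hu, hv, Finset.mul_sum, pow_zero, sub_self, zero_mul, mul_zero, zero_add]
    refine Finset.sum_congr rfl fun p _ => ?_
    ring
  rw [add_mul, ← h₁, ← h₂, ← h₃, Finset.mul_sum, ← Finset.sum_add_distrib,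
    ← Finset.sum_sub_distrib]
  refine Finset.sum_congr rfl fun p hp => ?_
  rw [← Finset.HasAntidiagonal.mem_antidiagonal.1 hp, pow_add]
  ring

/-- The coefficient of the `k`-th basis function in the expansion of `Hₙ`. -/
noncomputable def qHermiteCoeff (q : ℂ) (n k : ℕ) : ℂ :=
  qpoch (q ^ (-(n : ℤ))) q (2 * k) / qpoch (q ^ 2) (q ^ 2) k * (-q ^ (n + 1)) ^ k

theorem qHermiteCoeff_zero_right (q : ℂ) (n : ℕ) : qHermiteCoeff q n 0 = 1 := by
  simp [qHermiteCoeff, qpoch_zero]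

theorem qHermiteCoeff_eq_zero {q : ℂ} (hq : q ≠ 0) {n k : ℕ} (h : n < 2 * k) :
    qHermiteCoeff q n k = 0 := by
  rw [qHermiteCoeff, qpoch_inv_pow_eq_zero hq h, zero_div, zero_mul]

theorem qHermiteCoeff_one_recurrence {q : ℂ} (hq : q ≠ 0) (hq' : ∀ k : ℕ, 1 - q ^ (k + 1) ≠ 0)
    (n : ℕ) :
    qHermiteCoeff q (n + 4) 1 = qHermiteCoeff q (n + 2) 1 +
      (q ^ (n + 2) + q ^ (n + 3) - q ^ (n + 2) - (q ^ (n + 2))⁻¹) := by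
  have h2 : (1 - q ^ 2) ≠ 0 := hq' 1
  have hp : q ^ n ≠ 0 := pow_ne_zero n hq
  simp only [qHermiteCoeff, qpoch, Finset.prod_range_succ, Finset.prod_range_zero, zpow_neg,
    zpow_natCast, pow_add, mul_one, one_mul, pow_zero, pow_one]
  generalize q ^ n = p at *
  field_simp
  ring

theorem qHermiteCoeff_recurrence {q : ℂ} (hq : q ≠ 0) (hq' : ∀ k : ℕ, 1 - q ^ (k + 1) ≠ 0)
    (n k : ℕ) :
    qHermiteCoeff q (n + 4) (k + 2) = qHermiteCoeff q (n + 2) (k + 2) +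
      (q ^ (n + 2) + q ^ (n + 3) - q ^ (n + 2) / q ^ (2 * (k + 1)) -
        q ^ (2 * (k + 1)) / q ^ (n + 2)) * qHermiteCoeff q (n + 2) (k + 1) -
      (1 - q ^ (n + 2)) * (1 - q ^ (n + 1)) * qHermiteCoeff q n k := by
  have h₁ := hq' (2 * k + 1)
  have h₂ := hq' (2 * k + 3)
  have hp : q ^ n ≠ 0 := pow_ne_zero n hq
  have hr : q ^ k ≠ 0 := pow_ne_zero k hq
  have hB : qpoch (q ^ 2) (q ^ 2) k ≠ 0 := qpoch_self_ne_zero (fun j => by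
    rw [← pow_mul]; exact hq' (2 * j + 1)) k
  have e₁ : ∀ m : ℕ, q ^ (-((m + 1 : ℕ) : ℤ)) * q = q ^ (-(m : ℤ)) := fun m => by
    rw [← zpow_add_one₀ hq]; congr 1; push_cast; ring
  have s : ∀ m l : ℕ, qpoch (q ^ (-((m + 1 : ℕ) : ℤ))) q (l + 1) =
      (1 - q ^ (-((m + 1 : ℕ) : ℤ))) * qpoch (q ^ (-(m : ℤ))) q l := fun m l => by
    rw [qpoch_succ_left, e₁]
  have a₁ : qpoch (q ^ (-((n + 4 : ℕ) : ℤ))) q (2 * (k + 2)) =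
      (1 - (q ^ (n + 4))⁻¹) * ((1 - (q ^ (n + 3))⁻¹) * ((1 - (q ^ (n + 2))⁻¹) *
        ((1 - (q ^ (n + 1))⁻¹) * qpoch (q ^ (-(n : ℤ))) q (2 * k)))) := by
    rw [show 2 * (k + 2) = 2 * k + 3 + 1 by ring, s (n + 3), s (n + 2), s (n + 1), s n]
    simp only [zpow_neg, zpow_natCast]
  have a₂ : qpoch (q ^ (-((n + 2 : ℕ) : ℤ))) q (2 * (k + 2)) =
      (1 - (q ^ (n + 2))⁻¹) * ((1 - (q ^ (n + 1))⁻¹) * (qpoch (q ^ (-(n : ℤ))) q (2 * k) *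
        (1 - (q ^ n)⁻¹ * q ^ (2 * k)) * (1 - (q ^ n)⁻¹ * q ^ (2 * k + 1)))) := by
    rw [show 2 * (k + 2) = 2 * k + 2 + 1 + 1 by ring, s (n + 1), s n, qpoch_succ, qpoch_succ]
    simp only [zpow_neg, zpow_natCast]
  have a₃ : qpoch (q ^ (-((n + 2 : ℕ) : ℤ))) q (2 * (k + 1)) =
      (1 - (q ^ (n + 2))⁻¹) * ((1 - (q ^ (n + 1))⁻¹) * qpoch (q ^ (-(n : ℤ))) q (2 * k)) := by
    rw [show 2 * (k + 1) = 2 * k + 1 + 1 by ring, s (n + 1), s n]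
    simp only [zpow_neg, zpow_natCast]
  have p₁ : (-q ^ (n + 4 + 1)) ^ (k + 2) =
      (-q ^ (n + 1)) ^ k * ((q ^ k) ^ 4 * (q ^ (n + 5)) ^ 2) := by
    rw [show -q ^ (n + 4 + 1) = -q ^ (n + 1) * q ^ 4 by ring, mul_pow]; ring
  have p₂ : (-q ^ (n + 2 + 1)) ^ (k + 2) =
      (-q ^ (n + 1)) ^ k * ((q ^ k) ^ 2 * (q ^ (n + 3)) ^ 2) := by
    rw [show -q ^ (n + 2 + 1) = -q ^ (n + 1) * q ^ 2 by ring, mul_pow]; ring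
  have p₃ : (-q ^ (n + 2 + 1)) ^ (k + 1) =
      (-q ^ (n + 1)) ^ k * ((q ^ k) ^ 2 * -q ^ (n + 3)) := by
    rw [show -q ^ (n + 2 + 1) = -q ^ (n + 1) * q ^ 2 by ring, mul_pow]; ring
  have b₁ : qpoch (q ^ 2) (q ^ 2) (k + 1) =
      qpoch (q ^ 2) (q ^ 2) k * (1 - (q ^ k) ^ 2 * q ^ 2) := by
    rw [qpoch_succ]; ring
  have b₂ : qpoch (q ^ 2) (q ^ 2) (k + 2) =
      qpoch (q ^ 2) (q ^ 2) k * (1 - (q ^ k) ^ 2 * q ^ 2) * (1 - (q ^ k) ^ 2 * q ^ 4) := by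
    rw [qpoch_succ, b₁]; ring
  have c₁ : 1 - (q ^ k) ^ 2 * q ^ 2 ≠ 0 := by convert h₁ using 1; ring
  have c₂ : 1 - (q ^ k) ^ 2 * q ^ 4 ≠ 0 := by convert h₂ using 1; ring
  have r₁ : q ^ (2 * k) = (q ^ k) ^ 2 := by ring
  have r₂ : q ^ (2 * k + 1) = (q ^ k) ^ 2 * q := by ring
  have r₃ : q ^ (2 * (k + 1)) = (q ^ k) ^ 2 * q ^ 2 := by ring
  simp only [qHermiteCoeff]
  rw [a₁, a₂, a₃, p₁, p₂, p₃, b₁, b₂, r₁, r₂, r₃]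
  simp only [pow_add q n]
  generalize qpoch (q ^ 2) (q ^ 2) k = B at *
  generalize qpoch (q ^ (-(n : ℤ))) q (2 * k) = A at *
  generalize (-(q ^ n * q ^ 1)) ^ k = P at *
  generalize q ^ k = r at *
  generalize q ^ n = p at *
  obtain ⟨d₁, hd₁⟩ : ∃ d, d = 1 - r ^ 2 * q ^ 2 := ⟨_, rfl⟩
  obtain ⟨d₂, hd₂⟩ : ∃ d, d = 1 - r ^ 2 * q ^ 4 := ⟨_, rfl⟩
  rw [← hd₁] at c₁ ⊢
  rw [← hd₂] at c₂ ⊢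
  field_simp
  rw [hd₁, hd₂]
  ring

/-- A sequence with `κ (j + 2) = (W + q ^ j + q ^ (-j)) κ j` turns the coefficients
`qHermiteCoeff` into a solution of the two-step `q`-Hermite recurrence. -/
theorem sum_qHermiteCoeff_recurrence {q W : ℂ} (hq : q ≠ 0)
    (hq' : ∀ k : ℕ, 1 - q ^ (k + 1) ≠ 0) {κ : ℕ → ℂ}
    (hκ : ∀ j, κ (j + 2) = (W + q ^ j + (q ^ j)⁻¹) * κ j) (n N : ℕ) (hN : n < N) :
    ∑ k ∈ Finset.range (N + 2), qHermiteCoeff q (n + 4) k * κ (n + 4 - 2 * k) =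
      (W + q ^ (n + 2) + q ^ (n + 3)) *
        ∑ k ∈ Finset.range (N + 1), qHermiteCoeff q (n + 2) k * κ (n + 2 - 2 * k) -
      (1 - q ^ (n + 2)) * (1 - q ^ (n + 1)) *
        ∑ k ∈ Finset.range N, qHermiteCoeff q n k * κ (n - 2 * k) := by
  have key : ∀ k, (W + q ^ (n + 2) + q ^ (n + 3)) *
      (qHermiteCoeff q (n + 2) k * κ (n + 2 - 2 * k)) =
      qHermiteCoeff q (n + 2) k * κ (n + 4 - 2 * k) +
      (q ^ (n + 2) + q ^ (n + 3) - q ^ (n + 2) / q ^ (2 * k) - q ^ (2 * k) / q ^ (n + 2)) *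
        qHermiteCoeff q (n + 2) k * κ (n + 2 - 2 * k) := fun k => by
    rcases lt_or_ge (n + 2) (2 * k) with h | h
    · simp [qHermiteCoeff_eq_zero hq h]
    · obtain ⟨j, hj⟩ := Nat.exists_eq_add_of_le h
      rw [show n + 4 - 2 * k = j + 2 by omega, show n + 2 - 2 * k = j by omega, hκ,
        show q ^ (n + 2) / q ^ (2 * k) = q ^ j by
          rw [hj, pow_add]; field_simp,
        show q ^ (2 * k) / q ^ (n + 2) = (q ^ j)⁻¹ by
          rw [hj, pow_add]; field_simp]
      ring
  have hlast : qHermiteCoeff q (n + 2) (N + 1) = 0 := qHermiteCoeff_eq_zero hq (by omega)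
  have hsum : ∑ k ∈ Finset.range (N + 1), qHermiteCoeff q (n + 2) k * κ (n + 4 - 2 * k) =
      ∑ k ∈ Finset.range (N + 2), qHermiteCoeff q (n + 2) k * κ (n + 4 - 2 * k) := by
    rw [Finset.sum_range_succ _ (N + 1), hlast]; ring
  rw [Finset.mul_sum, Finset.mul_sum, Finset.sum_congr rfl fun k _ => key k,
    Finset.sum_add_distrib, hsum]
  rw [Finset.sum_range_succ' _ (N + 1), Finset.sum_range_succ' _ N,
    Finset.sum_range_succ' _ (N + 1), Finset.sum_range_succ' _ N,
    Finset.sum_range_succ' _ N]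
  have hterm : ∀ k, qHermiteCoeff q (n + 4) (k + 1 + 1) * κ (n + 4 - 2 * (k + 1 + 1)) =
      qHermiteCoeff q (n + 2) (k + 1 + 1) * κ (n + 4 - 2 * (k + 1 + 1)) +
      (q ^ (n + 2) + q ^ (n + 3) - q ^ (n + 2) / q ^ (2 * (k + 1)) -
        q ^ (2 * (k + 1)) / q ^ (n + 2)) * qHermiteCoeff q (n + 2) (k + 1) *
        κ (n + 2 - 2 * (k + 1)) -
      (1 - q ^ (n + 2)) * (1 - q ^ (n + 1)) * (qHermiteCoeff q n k * κ (n - 2 * k)) := fun k => by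
    rw [qHermiteCoeff_recurrence hq hq' n k, show n + 4 - 2 * (k + 1 + 1) = n - 2 * k by omega,
      show n + 2 - 2 * (k + 1) = n - 2 * k by omega]
    ring
  rw [Finset.sum_congr rfl fun k _ => hterm k, Finset.sum_sub_distrib, Finset.sum_add_distrib]
  have h1 := qHermiteCoeff_one_recurrence hq hq' n
  simp only [qHermiteCoeff_zero_right, zero_add, h1, mul_zero, pow_zero, mul_one, div_one,
    one_div, Nat.sub_zero, show n + 4 - 2 = n + 2 by omega]
  ring

theorem sum_range_qHermiteCoeff {q : ℂ} (hq : q ≠ 0) (κ : ℕ → ℂ) {n N : ℕ} (h : n / 2 < N) :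
    ∑ k ∈ Finset.range N, qHermiteCoeff q n k * κ (n - 2 * k) =
      ∑ k ∈ Finset.range (n / 2 + 1), qHermiteCoeff q n k * κ (n - 2 * k) := by
  refine (Finset.sum_subset (Finset.range_mono h) fun k _ hk => ?_).symm
  rw [qHermiteCoeff_eq_zero hq (by simp at hk; omega), zero_mul]

/-- The unnormalised expansion of a solution of the `q`-Hermite recurrence. -/
theorem eq_sum_qHermiteCoeff {q y : ℂ} (hq : q ≠ 0) (hq' : ∀ k : ℕ, 1 - q ^ (k + 1) ≠ 0)
    {H κ : ℕ → ℂ} (hH0 : H 0 = 1) (hH1 : H 1 = y)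
    (hH : ∀ n, H (n + 2) = y * H (n + 1) - (1 - q ^ (n + 1)) * H n)
    (hκ0 : κ 0 = 1) (hκ1 : κ 1 = y)
    (hκ : ∀ j, κ (j + 2) = (y ^ 2 - 2 + q ^ j + (q ^ j)⁻¹) * κ j) (n : ℕ) :
    H n = ∑ k ∈ Finset.range (n / 2 + 1), qHermiteCoeff q n k * κ (n - 2 * k) := by
  have h1 : 1 - q ≠ 0 := by simpa using hq' 0
  have h2 : 1 - q ^ 2 ≠ 0 := hq' 1
  induction n using Nat.strong_induction_on with
  | _ n ih =>
    match n, ih with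
    | 0, _ => simp [qHermiteCoeff_zero_right, hκ0, hH0]
    | 1, _ => simp [qHermiteCoeff_zero_right, hκ1, hH1]
    | 2, _ =>
      simp only [Finset.sum_range_succ, Finset.sum_range_zero, qHermiteCoeff_zero_right,
        hH 0, hH1, hH0, hκ0, hκ 0, Nat.reduceDiv, Nat.reduceMul, Nat.reduceSub, Nat.reduceAdd]
      simp only [qHermiteCoeff, qpoch, Finset.prod_range_succ, Finset.prod_range_zero, zpow_neg,
        zpow_natCast]
      field_simp
      ring
    | 3, _ =>
      simp only [Finset.sum_range_succ, Finset.sum_range_zero, qHermiteCoeff_zero_right,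
        hH 1, hH 0, hH1, hH0, hκ1, hκ 1, Nat.reduceDiv, Nat.reduceMul, Nat.reduceSub,
        Nat.reduceAdd]
      simp only [qHermiteCoeff, qpoch, Finset.prod_range_succ, Finset.prod_range_zero, zpow_neg,
        zpow_natCast]
      field_simp
      ring
    | n + 4, ih =>
      have h := sum_qHermiteCoeff_recurrence (W := y ^ 2 - 2) hq hq' hκ n (n + 1) (by omega)
      rw [sum_range_qHermiteCoeff hq κ (n := n + 4) (by omega),
        sum_range_qHermiteCoeff hq κ (n := n + 2) (by omega),
        sum_range_qHermiteCoeff hq κ (n := n) (by omega), ← ih n (by omega), ← ih (n + 2) (by omega)] at h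
      rw [h]
      linear_combination hH (n + 2) + y * hH (n + 1) + (1 - q ^ (n + 2)) * hH n

/-- Expansion of the monic continuous q-Hermite polynomial `2^{-n} Hₙ(x|q)` in the basis
`Kⱼ(x(s))` on the lattice `x(s) = (q^{-s}+q^s)/2` (with `Z = q^s = e^{iθ}`). -/
theorem stmt17 (q : ℝ) (hq0 : 0 < q) (hq1 : q < 1) (s : ℂ)
    (Z : ℂ) (hZ : Z = (q : ℂ) ^ s)
    (H : ℕ → ℂ)
    (hH : ∀ n : ℕ, H n = ∑ k ∈ Finset.range (n + 1),
      (qpoch (q : ℂ) (q : ℂ) n / (qpoch (q : ℂ) (q : ℂ) k * qpoch (q : ℂ) (q : ℂ) (n - k))) *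
        Z ^ ((n : ℤ) - 2 * (k : ℤ)))
    (K : ℕ → ℂ) (hK0 : K 0 = 1)
    (hK : ∀ j : ℕ, 1 ≤ j → K j = ((q : ℂ) ^ (-s) / 2) ^ j * (1 + Z ^ 2) *
      ∏ i ∈ Finset.range (j - 1), (1 + (q : ℂ) ^ ((2 : ℤ) - (j : ℤ)) * Z ^ 2 * ((q : ℂ) ^ 2) ^ i))
    (n : ℕ) :
    (2 : ℂ) ^ (-(n : ℤ)) * H n
      = ∑ k ∈ Finset.range (n / 2 + 1),
          (qpoch ((q : ℂ) ^ (-(n : ℤ))) (q : ℂ) (2 * k) / qpoch ((q : ℂ) ^ 2) ((q : ℂ) ^ 2) k) *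
            (-(q : ℂ) ^ (n + 1) / 4) ^ k * K (n - 2 * k) := by
  have hq : (q : ℂ) ≠ 0 := by exact_mod_cast hq0.ne'
  have hq' : ∀ k : ℕ, 1 - (q : ℂ) ^ (k + 1) ≠ 0 := fun k h => by
    have h' : (q : ℝ) ^ (k + 1) = 1 := by exact_mod_cast (sub_eq_zero.1 h).symm
    exact (pow_lt_one₀ hq0.le hq1 k.succ_ne_zero).ne h'
  have hZ0 : Z ≠ 0 := by simp [hZ, Complex.cpow_eq_zero_iff, hq]
  have hZinv : (q : ℂ) ^ (-s) = Z⁻¹ := by rw [hZ, Complex.cpow_neg]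
  have hQ := qpoch_self_ne_zero hq'
  set S : ℕ → ℂ := fun n => ∑ p ∈ Finset.HasAntidiagonal.antidiagonal n,
    (Z ^ p.1 / qpoch q q p.1) * (Z⁻¹ ^ p.2 / qpoch q q p.2) with hS
  have hHS : ∀ n, H n = qpoch q q n * S n := fun n => by
    rw [hH, hS]
    simp only
    rw [← Finset.Nat.sum_antidiagonal_swap, Finset.Nat.sum_antidiagonal_eq_sum_range_succ_mk,
      Finset.mul_sum]
    refine Finset.sum_congr rfl fun k hk => ?_
    have hkn : k ≤ n := Nat.lt_succ_iff.1 (Finset.mem_range.1 hk)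
    have : Z ^ ((n : ℤ) - 2 * (k : ℤ)) = Z ^ (n - k) * Z⁻¹ ^ k := by
      rw [← zpow_natCast, ← zpow_natCast, inv_zpow', ← zpow_add₀ hZ0]
      congr 1
      push_cast [hkn]
      ring
    rw [this]
    simp only [Prod.swap]
    field_simp
  have hstep : ∀ (z : ℂ) (i : ℕ), (1 - (q : ℂ) ^ (i + 1)) * (z ^ (i + 1) / qpoch q q (i + 1)) =
      z * (z ^ i / qpoch q q i) := fun z i => by
    have h₁ := hQ i
    have h₂ := hq' i
    rw [qpoch_succ, ← pow_succ']
    field_simp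
    ring
  have hrec : ∀ n, H (n + 2) = (Z + Z⁻¹) * H (n + 1) - (1 - (q : ℂ) ^ (n + 1)) * H n := fun n => by
    have h := sum_antidiagonal_recurrence (u := fun i => Z ^ i / qpoch q q i)
      (v := fun i => Z⁻¹ ^ i / qpoch q q i) (hstep Z) (hstep Z⁻¹) n
    rw [mul_inv_cancel₀ hZ0] at h
    rw [hHS, hHS, hHS, qpoch_succ, qpoch_succ]
    simp only [hS]
    linear_combination (qpoch (q : ℂ) q n * (1 - (q : ℂ) ^ (n + 1))) * h
  have hH0 : H 0 = 1 := by simp [hHS, hS, qpoch_zero]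
  have hH1 : H 1 = Z + Z⁻¹ := by
    have h1 : 1 - (q : ℂ) ≠ 0 := by simpa using hq' 0
    simp [hHS, hS, qpoch, Finset.Nat.antidiagonal_succ]
    field_simp
    ring
  have hκ : ∀ j, (2 : ℂ) ^ (j + 2) * K (j + 2) =
      ((Z + Z⁻¹) ^ 2 - 2 + (q : ℂ) ^ j + ((q : ℂ) ^ j)⁻¹) * (2 ^ j * K j) := fun j => by
    rcases j with _ | j
    · rw [hK0, hK 2 (by norm_num), hZinv]
      simp
      field_simp
      ring
    · rw [hK (j + 1) (by omega), hK (j + 1 + 2) (by omega), hZinv,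
        show j + 1 + 2 - 1 = j + 1 + 1 by omega, Finset.prod_range_succ, Finset.prod_range_succ',
        show j + 1 - 1 = j by omega]
      have hprod : ∀ i ∈ Finset.range j,
          1 + (q : ℂ) ^ ((2 : ℤ) - ((j + 1 + 2 : ℕ) : ℤ)) * Z ^ 2 * ((q : ℂ) ^ 2) ^ (i + 1) =
          1 + (q : ℂ) ^ ((2 : ℤ) - ((j + 1 : ℕ) : ℤ)) * Z ^ 2 * ((q : ℂ) ^ 2) ^ i := fun i _ => by
        rw [show (2 : ℤ) - ((j + 1 : ℕ) : ℤ) = (2 - ((j + 1 + 2 : ℕ) : ℤ)) + (2 : ℕ) by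
          push_cast; ring, zpow_add₀ hq, zpow_natCast]
        ring
      rw [Finset.prod_congr rfl hprod,
        show (2 : ℤ) - ((j + 1 + 2 : ℕ) : ℤ) = -((j + 1 : ℕ) : ℤ) by push_cast; ring,
        zpow_neg, zpow_natCast]
      generalize ∏ i ∈ Finset.range j,
        (1 + (q : ℂ) ^ ((2 : ℤ) - ((j + 1 : ℕ) : ℤ)) * Z ^ 2 * ((q : ℂ) ^ 2) ^ i) = R
      have hr : ((q : ℂ) ^ 2) ^ (j + 1) = ((q : ℂ) ^ (j + 1)) ^ 2 := by ring
      rw [hr, pow_zero]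
      have hp : (q : ℂ) ^ (j + 1) ≠ 0 := pow_ne_zero _ hq
      generalize (q : ℂ) ^ (j + 1) = p at *
      rw [pow_add _ (j + 1) 2, pow_add _ (j + 1) 2, div_pow _ _ (j + 1)]
      field_simp
      ring
  have hκ1 : (2 : ℂ) ^ 1 * K 1 = Z + Z⁻¹ := by
    rw [hK 1 le_rfl, hZinv]
    simp
    field_simp
    ring
  rw [eq_sum_qHermiteCoeff (κ := fun j => 2 ^ j * K j) hq hq' hH0 hH1 hrec (by simp [hK0])
    hκ1 hκ n, Finset.mul_sum]
  refine Finset.sum_congr rfl fun k hk => ?_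
  have hk' : 2 * k ≤ n := by
    have := Finset.mem_range.1 hk
    omega
  obtain ⟨j, rfl⟩ := Nat.exists_eq_add_of_le hk'
  rw [Nat.add_sub_cancel_left, qHermiteCoeff, div_pow _ (4 : ℂ), zpow_neg, zpow_natCast,
    pow_add 2 (2 * k) j, pow_mul 2 2 k, show (2 : ℂ) ^ 2 = 4 by norm_num]
  field_simp
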